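/- Let D > 0, w ∈ ℝ², and let I₀ : ℝ² → ℝ be a Schwartz function. Let u : ℝ² × [0, ∞) → ℝ be continuous with u(·, 0) = I₀, smooth on ℝ² × (0, ∞), such that for each t ≥ 0 the function u(·, t) is a Schwartz function, such that there is an integrable function g : ℝ² → ℝ with |u(x, t)| ≤ g(x) and |∂u/∂t (x, t)| ≤ g(x) for all x and all t in any fixed compact subinterval of (0, ∞), with sup over x of |u(x,t) − I₀(x)| · (1 + ‖x‖)⁻³ → 0 as t → 0⁺, and such that u satisfies the advection–diffusion equation ∂u/∂t + ⟨w, ∇ₓu⟩ = D Δₓ u on ℝ² × (0, ∞). Then u is uniquely determined: for every x ∈ ℝ² and t > 0, u(x, t) = ∫_{ℝ²} (4πDt)⁻¹ exp(−‖x − tw − y‖²/(4Dt)) I₀(y) dy. -/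

import Mathlib

open MeasureTheory Real Set

/-- The advected heat kernel `k_t(x, y) = (4πDt)⁻¹ exp(−‖x − tw − y‖²/(4Dt))`. -/
noncomputable def advKernel (D t : ℝ) (w x y : EuclideanSpace ℝ (Fin 2)) : ℝ :=
  (4 * π * D * t)⁻¹ * Real.exp (-‖x - t • w - y‖ ^ 2 / (4 * D * t))

/-- The spatial Laplacian: sum of the two second partial derivatives. -/
noncomputable def laplacian (f : EuclideanSpace ℝ (Fin 2) → ℝ)
    (x : EuclideanSpace ℝ (Fin 2)) : ℝ :=
  ∑ i : Fin 2,
    fderiv ℝ (fun y => fderiv ℝ f y (EuclideanSpace.single i 1)) x (EuclideanSpace.single i 1)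


open Filter Topology

abbrev E2 := EuclideanSpace ℝ (Fin 2)

lemma advK_hasFDerivAt (D τ : ℝ) (w x y : E2) :
    HasFDerivAt (advKernel D τ w x)
      ((advKernel D τ w x y * (2 * D * τ)⁻¹) • innerSL ℝ (x - τ • w - y)) y := by
  have h1 : HasFDerivAt (fun y : E2 => x - τ • w - y) (-ContinuousLinearMap.id ℝ E2) y := by
    simpa using (hasFDerivAt_id y).const_sub (x - τ • w)
  have h2 := (((h1.norm_sq).neg.mul_const ((4 * D * τ)⁻¹)).exp).const_mul ((4 * π * D * τ)⁻¹)
  have he : advKernel D τ w x = fun y => (4 * π * D * τ)⁻¹ *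
      Real.exp (-‖x - τ • w - y‖ ^ 2 * (4 * D * τ)⁻¹) := by
    funext y; simp [advKernel, div_eq_mul_inv]
  rw [he]
  refine h2.congr_fderiv ?_
  ext v
  simp
  ring

lemma advK_continuous (D τ : ℝ) (w x : E2) : Continuous (advKernel D τ w x) := by
  unfold advKernel; fun_prop

lemma advK1_hasFDerivAt (D τ : ℝ) (w x y v : E2) :
    HasFDerivAt (fun y => advKernel D τ w x y * (2 * D * τ)⁻¹ * inner ℝ (x - τ • w - y) v)
      ((advKernel D τ w x y * (2 * D * τ)⁻¹) • (-(innerSL ℝ v)) + 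
        (inner ℝ (x - τ • w - y) v) • ((2 * D * τ)⁻¹ • 
        ((advKernel D τ w x y * (2 * D * τ)⁻¹) • innerSL ℝ (x - τ • w - y)))) y := by
  have h1 : HasFDerivAt (fun y : E2 => x - τ • w - y) (-ContinuousLinearMap.id ℝ E2) y := by
    simpa using (hasFDerivAt_id y).const_sub (x - τ • w)
  have h2 := h1.inner ℝ (hasFDerivAt_const v y)
  have h3 := ((advK_hasFDerivAt D τ w x y).mul_const ((2 * D * τ)⁻¹)).mul h2
  refine h3.congr_fderiv ?_
  ext z
  simp [real_inner_comm]

lemma advK_nonneg {D τ : ℝ} (hD : 0 < D) (hτ : 0 < τ) (w x y : E2) :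
    0 ≤ advKernel D τ w x y := by unfold advKernel; positivity

lemma advK_le {D τ : ℝ} (hD : 0 < D) (hτ : 0 < τ) (w x y : E2) :
    advKernel D τ w x y ≤ (4 * π * D * τ)⁻¹ := by
  unfold advKernel
  refine mul_le_of_le_one_right (by positivity) ?_
  rw [Real.exp_le_one_iff, neg_div]
  have : 0 ≤ ‖x - τ • w - y‖ ^ 2 / (4 * D * τ) := by positivity
  linarith

lemma advK_sq_le {D τ : ℝ} (hD : 0 < D) (hτ : 0 < τ) (w x y : E2) :
    advKernel D τ w x y * ‖x - τ • w - y‖ ^ 2 ≤ (4 * π * D * τ)⁻¹ * (4 * D * τ) := by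
  unfold advKernel
  rw [mul_assoc]
  refine mul_le_mul_of_nonneg_left ?_ (by positivity)
  set z := ‖x - τ • w - y‖ ^ 2 / (4 * D * τ) with hz
  have hr : ‖x - τ • w - y‖ ^ 2 = z * (4 * D * τ) := by rw [hz]; field_simp
  rw [neg_div, ← hz, hr, ← mul_assoc]
  refine mul_le_of_le_one_left (by positivity) ?_
  rw [Real.exp_neg, inv_mul_le_iff₀ (Real.exp_pos _)]
  have := Real.add_one_le_exp z
  linarith

lemma advK_one_le {D τ : ℝ} (hD : 0 < D) (hτ : 0 < τ) (w x y : E2) :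
    advKernel D τ w x y * ‖x - τ • w - y‖ ≤ (4 * π * D * τ)⁻¹ * (1 + 4 * D * τ) := by
  have h1 := advK_le hD hτ w x y
  have h2 := advK_sq_le hD hτ w x y
  have h0 := advK_nonneg hD hτ w x y
  have : ‖x - τ • w - y‖ ≤ 1 + ‖x - τ • w - y‖ ^ 2 := by nlinarith [sq_nonneg (‖x - τ • w - y‖ - 1)]
  have := mul_le_mul_of_nonneg_left this h0
  linarith

lemma ibp (φ : SchwartzMap E2 ℝ) (f : E2 → ℝ) (f' : E2 → (E2 →L[ℝ] ℝ)) (v : E2)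
    (hf : ∀ y, HasFDerivAt f (f' y) y) (C C' : ℝ) (hC : ∀ y, |f y| ≤ C)
    (hC' : ∀ y, |f' y v| ≤ C') (hc : Continuous fun y => f' y v) :
    Integrable (fun y => f' y v * φ y) ∧ Integrable (fun y => f y * fderiv ℝ φ y v) ∧
    ∫ y, f y * fderiv ℝ φ y v = - ∫ y, f' y v * φ y := by
  have hfc : Continuous f := continuous_iff_continuousAt.2 fun y => (hf y).continuousAt
  have hd : Integrable (fun y => fderiv ℝ φ y v) := 
    (LineDeriv.lineDerivOp v φ : SchwartzMap E2 ℝ).integrable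
  have i1 : Integrable (fun y => f' y v * φ y) :=
    φ.integrable.bdd_mul hc.aestronglyMeasurable (c := C') (ae_of_all _ hC')
  have i2 : Integrable (fun y => f y * fderiv ℝ φ y v) :=
    hd.bdd_mul hfc.aestronglyMeasurable (c := C) (ae_of_all _ hC)
  have i3 : Integrable (fun y => f y * φ y) :=
    φ.integrable.bdd_mul hfc.aestronglyMeasurable (c := C) (ae_of_all _ hC)
  refine ⟨i1, i2, ?_⟩
  have hfd : ∀ y, fderiv ℝ f y = f' y := fun y => (hf y).fderiv
  have := integral_mul_fderiv_eq_neg_fderiv_mul_of_integrable (f := f) (g := φ) (v := v)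
    (μ := volume) (by simpa only [hfd] using i1) i2 i3 (fun y _ => (hf y).differentiableAt)
    (fun y _ => φ.differentiableAt)
  simpa only [hfd] using this

lemma advK_time (D t s : ℝ) (hD : 0 < D) (hs : s < t) (w x y : E2) :
    HasDerivAt (fun s => advKernel D (t - s) w x y)
      (advKernel D (t - s) w x y * ((t - s)⁻¹ - ‖x - (t - s) • w - y‖ ^ 2 / (4 * D * (t - s) ^ 2)
        - inner ℝ (x - (t - s) • w - y) w / (2 * D * (t - s)))) s := by
  have hτ : 0 < t - s := by linarith
  have h0 : HasDerivAt (fun s : ℝ => t - s) (-1) s := by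
    simpa using (hasDerivAt_id s).const_sub t
  have h1 : HasDerivAt (fun s : ℝ => x - (t - s) • w - y) w s := by
    simpa using ((h0.smul_const w).const_sub x).sub_const y
  have h2 := (h1.norm_sq).neg.div (h0.const_mul (4 * D)) (by positivity)
  have h3 := (h0.const_mul (4 * π * D)).inv (by positivity)
  have h4 := h3.mul h2.exp
  refine h4.congr_deriv ?_
  unfold advKernel
  simp only [Pi.neg_apply, Pi.div_apply, Pi.inv_apply]
  field_simp
  ring

lemma advK_time_bound {D t s α : ℝ} (hD : 0 < D) (hα : 0 < α) (hs : α ≤ t - s) (w x y : E2) :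
    |advKernel D (t - s) w x y * ((t - s)⁻¹ - ‖x - (t - s) • w - y‖ ^ 2 / (4 * D * (t - s) ^ 2)
        - inner ℝ (x - (t - s) • w - y) w / (2 * D * (t - s)))| ≤
      (4 * π * D * α)⁻¹ * (2 * α⁻¹ + ((2 * D * α)⁻¹ + 2) * ‖w‖) := by
  have hτ : 0 < t - s := by linarith
  have h0 := advK_nonneg hD hτ w x y
  have h1 := advK_le hD hτ w x y
  have h2 := advK_sq_le hD hτ w x y
  have h3 := advK_one_le hD hτ w x y
  have hin := abs_real_inner_le_norm (x - (t - s) • w - y) w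
  generalize t - s = τ at *
  set k := advKernel D τ w x y
  set r := ‖x - τ • w - y‖
  set i := inner ℝ (x - τ • w - y) w
  have : |k * (τ⁻¹ - r ^ 2 / (4 * D * τ ^ 2) - i / (2 * D * τ))| ≤
      (4 * π * D * τ)⁻¹ * (2 * τ⁻¹ + ((2 * D * τ)⁻¹ + 2) * ‖w‖) := by
    calc _ ≤ k * (τ⁻¹ + r ^ 2 / (4 * D * τ ^ 2) + (r * ‖w‖) / (2 * D * τ)) := by
          rw [abs_mul, abs_of_nonneg h0]
          refine mul_le_mul_of_nonneg_left ?_ h0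
          have a1 : |τ⁻¹| = τ⁻¹ := abs_of_nonneg (by positivity)
          have a2 : |r ^ 2 / (4 * D * τ ^ 2)| = r ^ 2 / (4 * D * τ ^ 2) := abs_of_nonneg (by positivity)
          have a3 : |i / (2 * D * τ)| ≤ (r * ‖w‖) / (2 * D * τ) := by
            rw [abs_div, abs_of_pos (show 0 < 2 * D * τ by positivity)]
            gcongr
          have b1 := abs_sub (τ⁻¹ - r ^ 2 / (4 * D * τ ^ 2)) (i / (2 * D * τ))
          have b2 := abs_sub (τ⁻¹) (r ^ 2 / (4 * D * τ ^ 2))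
          linarith
      _ = k * τ⁻¹ + (k * r ^ 2) / (4 * D * τ ^ 2) + (k * r) * ‖w‖ / (2 * D * τ) := by ring
      _ ≤ (4 * π * D * τ)⁻¹ * τ⁻¹ + ((4 * π * D * τ)⁻¹ * (4 * D * τ)) / (4 * D * τ ^ 2) + 
          ((4 * π * D * τ)⁻¹ * (1 + 4 * D * τ)) * ‖w‖ / (2 * D * τ) := by gcongr
      _ = _ := by field_simp; ring
  refine this.trans ?_
  gcongr

lemma integral_four {a b c d : E2 → ℝ} (ha : Integrable a) (hb : Integrable b)
    (hc : Integrable c) (hd : Integrable d) :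
    ∫ y, (a y + b y - (c y + d y)) = (∫ y, a y) + (∫ y, b y) - ((∫ y, c y) + ∫ y, d y) := by
  rw [← integral_add ha hb, ← integral_add hc hd]
  exact integral_sub (ha.add hb) (hc.add hd)

lemma adjoint_identity {D τ : ℝ} (hD : 0 < D) (hτ : 0 < τ) (w x : E2) (φ : SchwartzMap E2 ℝ) :
    ∫ y, (advKernel D τ w x y * (τ⁻¹ - ‖x - τ • w - y‖ ^ 2 / (4 * D * τ ^ 2)
        - inner ℝ (x - τ • w - y) w / (2 * D * τ)) * φ y +
        advKernel D τ w x y * (D * laplacian φ y - fderiv ℝ φ y w)) = 0 := by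
  set A := (4 * π * D * τ)⁻¹ with hA
  have hA0 : 0 < A := by positivity
  set c := (2 * D * τ)⁻¹ with hc
  have hc0 : 0 < c := by positivity
  have kb : ∀ y, |advKernel D τ w x y| ≤ A := fun y => by
    rw [abs_of_nonneg (advK_nonneg hD hτ w x y)]; exact advK_le hD hτ w x y
  have k1b : ∀ v y, |advKernel D τ w x y * c * inner ℝ (x - τ • w - y) v| ≤
      A * (1 + 4 * D * τ) * c * ‖v‖ := fun v y => by
    rw [abs_mul, abs_mul, abs_of_nonneg (advK_nonneg hD hτ w x y), abs_of_pos hc0]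
    calc _ ≤ advKernel D τ w x y * c * (‖x - τ • w - y‖ * ‖v‖) := by
          have := advK_nonneg hD hτ w x y
          gcongr; exact abs_real_inner_le_norm _ _
      _ = (advKernel D τ w x y * ‖x - τ • w - y‖) * c * ‖v‖ := by ring
      _ ≤ _ := by
          have := advK_one_le hD hτ w x y
          exact mul_le_mul_of_nonneg_right (mul_le_mul_of_nonneg_right this hc0.le) (norm_nonneg v)
  have kc := advK_continuous D τ w x
  have I1 : ∀ (v : E2) (ψ : SchwartzMap E2 ℝ),
      Integrable (fun y => advKernel D τ w x y * c * inner ℝ (x - τ • w - y) v * ψ y) ∧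
      Integrable (fun y => advKernel D τ w x y * fderiv ℝ ψ y v) ∧
      ∫ y, advKernel D τ w x y * fderiv ℝ ψ y v = 
        - ∫ y, advKernel D τ w x y * c * inner ℝ (x - τ • w - y) v * ψ y := fun v ψ => by
    have := ibp ψ (advKernel D τ w x) _ v (advK_hasFDerivAt D τ w x) A
      (A * (1 + 4 * D * τ) * c * ‖v‖) kb (fun y => by
        simp only [smul_apply, innerSL_apply_apply, smul_eq_mul]; exact k1b v y)
      (by simp only [smul_apply, innerSL_apply_apply, smul_eq_mul]; fun_prop)
    simp only [smul_apply, innerSL_apply_apply, smul_eq_mul] at this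
    exact this
  have I2 : ∀ (v : E2), 
      Integrable (fun y => (advKernel D τ w x y * c * (-‖v‖ ^ 2 + c * inner ℝ (x - τ • w - y) v ^ 2)) * φ y) ∧
      Integrable (fun y => advKernel D τ w x y * c * inner ℝ (x - τ • w - y) v * fderiv ℝ φ y v) ∧
      ∫ y, advKernel D τ w x y * c * inner ℝ (x - τ • w - y) v * fderiv ℝ φ y v = 
        - ∫ y, (advKernel D τ w x y * c * (-‖v‖ ^ 2 + c * inner ℝ (x - τ • w - y) v ^ 2)) * φ y := fun v => by
    have he : ∀ y, ((advKernel D τ w x y * (2 * D * τ)⁻¹) • (-(innerSL ℝ v)) + 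
        (inner ℝ (x - τ • w - y) v) • ((2 * D * τ)⁻¹ • 
        ((advKernel D τ w x y * (2 * D * τ)⁻¹) • innerSL ℝ (x - τ • w - y)))) v =
        (advKernel D τ w x y * c * (-‖v‖ ^ 2 + c * inner ℝ (x - τ • w - y) v ^ 2)) := fun y => by
      simp only [smul_apply, add_apply, neg_apply, innerSL_apply_apply, smul_eq_mul,
        real_inner_self_eq_norm_sq]
      rw [← hc]
      ring
    have := ibp φ _ _ v (fun y => advK1_hasFDerivAt D τ w x y v) 
      (A * (1 + 4 * D * τ) * c * ‖v‖) (A * c * ‖v‖ ^ 2 + A * (4 * D * τ) * c ^ 2 * ‖v‖ ^ 2) (k1b v) (fun y => by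
        rw [he, abs_mul, abs_mul, abs_of_nonneg (advK_nonneg hD hτ w x y), abs_of_pos hc0]
        have k0 := advK_nonneg hD hτ w x y
        have hin : inner ℝ (x - τ • w - y) v ^ 2 ≤ ‖x - τ • w - y‖ ^ 2 * ‖v‖ ^ 2 := by
          rw [← sq_abs, ← mul_pow]
          gcongr; exact abs_real_inner_le_norm _ _
        calc _ ≤ advKernel D τ w x y * c * (‖v‖ ^ 2 + c * (‖x - τ • w - y‖ ^ 2 * ‖v‖ ^ 2)) := by
              gcongr
              refine (abs_add_le _ _).trans ?_
              rw [abs_neg, abs_of_nonneg (sq_nonneg ‖v‖), abs_of_nonneg (by positivity)]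
              gcongr
          _ = advKernel D τ w x y * c * ‖v‖ ^ 2 + 
                (advKernel D τ w x y * ‖x - τ • w - y‖ ^ 2) * c ^ 2 * ‖v‖ ^ 2 := by ring
          _ ≤ _ := by
              refine add_le_add ?_ ?_
              · exact mul_le_mul_of_nonneg_right (mul_le_mul_of_nonneg_right
                  (advK_le hD hτ w x y) hc0.le) (sq_nonneg _)
              · exact mul_le_mul_of_nonneg_right (mul_le_mul_of_nonneg_right
                  (advK_sq_le hD hτ w x y) (sq_nonneg _)) (sq_nonneg _))
      (by simp only [he]; fun_prop)
    simpa only [he] using this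
  set e : Fin 2 → E2 := fun i => EuclideanSpace.single i 1 with hedef
  have J : ∀ v : E2, Integrable (fun y => advKernel D τ w x y * 
        fderiv ℝ (fun z => fderiv ℝ φ z v) y v) ∧ 
      ∫ y, advKernel D τ w x y * fderiv ℝ (fun z => fderiv ℝ φ z v) y v =
      ∫ y, (advKernel D τ w x y * c * (-‖v‖ ^ 2 + c * inner ℝ (x - τ • w - y) v ^ 2)) * φ y := fun v => by
    have h := I1 v (LineDeriv.lineDerivOp v φ : SchwartzMap E2 ℝ)
    have hψ : (⇑(LineDeriv.lineDerivOp v φ : SchwartzMap E2 ℝ)) = fun z => fderiv ℝ φ z v := rfl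
    rw [hψ] at h
    refine ⟨h.2.1, ?_⟩
    rw [h.2.2, (I2 v).2.2, neg_neg]
  have hsq : ∀ z : E2, ‖z‖ ^ 2 = inner ℝ z (e 0) ^ 2 + inner ℝ z (e 1) ^ 2 := fun z => by
    rw [EuclideanSpace.norm_sq_eq]
    simp [hedef, Fin.sum_univ_two, EuclideanSpace.inner_single_right]
  have hne : ∀ i, ‖e i‖ = 1 := fun i => by simp [hedef]
  have hstep : ∀ y, (advKernel D τ w x y * (τ⁻¹ - ‖x - τ • w - y‖ ^ 2 / (4 * D * τ ^ 2)
        - inner ℝ (x - τ • w - y) w / (2 * D * τ)) * φ y +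
        advKernel D τ w x y * (D * laplacian φ y - fderiv ℝ φ y w)) =
      (D * ((advKernel D τ w x y * fderiv ℝ (fun z => fderiv ℝ φ z (e 0)) y (e 0)) -
        (advKernel D τ w x y * c * (-‖e 0‖ ^ 2 + c * inner ℝ (x - τ • w - y) (e 0) ^ 2)) * φ y) +
      D * ((advKernel D τ w x y * fderiv ℝ (fun z => fderiv ℝ φ z (e 1)) y (e 1)) -
        (advKernel D τ w x y * c * (-‖e 1‖ ^ 2 + c * inner ℝ (x - τ • w - y) (e 1) ^ 2)) * φ y)) -
      (advKernel D τ w x y * fderiv ℝ φ y w + 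
        advKernel D τ w x y * c * inner ℝ (x - τ • w - y) w * φ y) := fun y => by
    have hl : laplacian φ y = fderiv ℝ (fun z => fderiv ℝ φ z (e 0)) y (e 0) + 
        fderiv ℝ (fun z => fderiv ℝ φ z (e 1)) y (e 1) := by
      rw [laplacian, Fin.sum_univ_two]
    rw [hsq (x - τ • w - y), hne, hne, hl, hc]
    generalize inner ℝ (x - τ • w - y) (e 0) = i0
    generalize inner ℝ (x - τ • w - y) (e 1) = i1
    generalize inner ℝ (x - τ • w - y) w = i2
    field_simp
    ring
  simp_rw [hstep]
  have P : ∀ v, Integrable (fun y => D * ((advKernel D τ w x y * fderiv ℝ (fun z => fderiv ℝ φ z v) y v) -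
        (advKernel D τ w x y * c * (-‖v‖ ^ 2 + c * inner ℝ (x - τ • w - y) v ^ 2)) * φ y)) :=
    fun v => ((J v).1.sub (I2 v).1).const_mul D
  have P0 : ∀ v, ∫ y, D * ((advKernel D τ w x y * fderiv ℝ (fun z => fderiv ℝ φ z v) y v) -
        (advKernel D τ w x y * c * (-‖v‖ ^ 2 + c * inner ℝ (x - τ • w - y) v ^ 2)) * φ y) = 0 :=
    fun v => by
      rw [integral_const_mul, integral_sub (J v).1 (I2 v).1, (J v).2, sub_self, mul_zero]
  rw [integral_four (P _) (P _) (I1 w φ).2.1 (I1 w φ).1, P0, P0, (I1 w φ).2.2]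
  simp

lemma gauss_integral {D : ℝ} (hD : 0 < D) :
    Integrable (fun z : E2 => (4 * π * D)⁻¹ * Real.exp (-‖z‖ ^ 2 / (4 * D))) ∧
    ∫ z : E2, (4 * π * D)⁻¹ * Real.exp (-‖z‖ ^ 2 / (4 * D)) = 1 := by
  have hb : 0 < (4 * D)⁻¹ := by positivity
  have h := GaussianFourier.integral_rexp_neg_mul_sq_norm (V := E2) hb
  have he : ∀ z : E2, -‖z‖ ^ 2 / (4 * D) = -(4 * D)⁻¹ * ‖z‖ ^ 2 := fun z => by ring
  have h1 : ∫ z : E2, (4 * π * D)⁻¹ * Real.exp (-‖z‖ ^ 2 / (4 * D)) = 1 := by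
    rw [integral_const_mul]
    simp_rw [he]
    rw [h]
    simp
    field_simp
  refine ⟨?_, h1⟩
  by_contra hn
  rw [integral_undef hn] at h1
  norm_num at h1

lemma subst_kernel {D τ : ℝ} (hD : 0 < D) (hτ : 0 < τ) (w x : E2) (φ : E2 → ℝ) :
    ∫ y, advKernel D τ w x y * φ y = 
      ∫ z : E2, (4 * π * D)⁻¹ * Real.exp (-‖z‖ ^ 2 / (4 * D)) * φ (x - τ • w - √τ • z) := by
  rw [← integral_sub_left_eq_self _ volume (x - τ • w)]
  have h := Measure.integral_comp_smul (volume : Measure E2)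
    (fun z => advKernel D τ w x (x - τ • w - z) * φ (x - τ • w - z)) (√τ)
  have hs : √τ ^ 2 = τ := Real.sq_sqrt hτ.le
  have hs0 : 0 < √τ := Real.sqrt_pos.2 hτ
  simp only [finrank_euclideanSpace, Fintype.card_fin, hs, abs_of_pos (inv_pos.2 hτ),
    smul_eq_mul] at h
  rw [eq_inv_mul_iff_mul_eq₀ hτ.ne'] at h
  rw [← h, ← integral_const_mul]
  congr 1
  funext z
  unfold advKernel
  rw [sub_sub_cancel, norm_smul, mul_pow, Real.norm_of_nonneg hs0.le, hs]
  have : -(τ * ‖z‖ ^ 2) / (4 * D * τ) = -‖z‖ ^ 2 / (4 * D) := by field_simp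
  rw [this]
  field_simp

lemma approx_id {D : ℝ} (hD : 0 < D) (w x : E2) (φ : SchwartzMap E2 ℝ) :
    Tendsto (fun τ => ∫ y, advKernel D τ w x y * φ y) (𝓝[>] 0) (𝓝 (φ x)) := by
  obtain ⟨gi, g1⟩ := gauss_integral hD
  have key : Tendsto (fun τ : ℝ => ∫ z : E2, (4 * π * D)⁻¹ * Real.exp (-‖z‖ ^ 2 / (4 * D)) * 
      φ (x - τ • w - √τ • z)) (𝓝[>] 0) (𝓝 (∫ z : E2, (4 * π * D)⁻¹ * 
      Real.exp (-‖z‖ ^ 2 / (4 * D)) * φ x)) := by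
    refine tendsto_integral_filter_of_dominated_convergence
      (fun z => (4 * π * D)⁻¹ * Real.exp (-‖z‖ ^ 2 / (4 * D)) * (SchwartzMap.seminorm ℝ 0 0) φ)
      ?_ ?_ (gi.mul_const _) ?_
    · refine Eventually.of_forall fun τ => Continuous.aestronglyMeasurable ?_
      have := φ.continuous
      fun_prop
    · refine Eventually.of_forall fun τ => Eventually.of_forall fun z => ?_
      rw [norm_mul, Real.norm_of_nonneg (by positivity)]
      gcongr
      exact SchwartzMap.norm_le_seminorm ℝ φ _
    · refine Eventually.of_forall fun z => ?_
      refine Tendsto.const_mul _ ?_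
      have hc : Continuous (fun τ : ℝ => φ (x - τ • w - √τ • z)) := by
        have := φ.continuous
        fun_prop
      have := hc.tendsto 0
      simp at this
      exact this.mono_left nhdsWithin_le_nhds
  rw [integral_mul_const, g1, one_mul] at key
  refine key.congr' ?_
  filter_upwards [self_mem_nhdsWithin] with τ hτ
  rw [subst_kernel hD hτ]

lemma u_hasDerivAt {u : E2 → ℝ → ℝ}
    (hsmooth : ContDiffOn ℝ (⊤ : ℕ∞) (fun p : E2 × ℝ => u p.1 p.2)
      (Set.univ ×ˢ Set.Ioi (0 : ℝ))) (y : E2) {s : ℝ} (hs : 0 < s) :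
    HasDerivAt (u y) (deriv (u y) s) s := by
  have ho : IsOpen ((Set.univ : Set E2) ×ˢ Set.Ioi (0 : ℝ)) := isOpen_univ.prod isOpen_Ioi
  have h1 : DifferentiableAt ℝ (fun p : E2 × ℝ => u p.1 p.2) (y, s) :=
    (hsmooth.contDiffAt (ho.mem_nhds (Set.mk_mem_prod (Set.mem_univ y) (Set.mem_Ioi.2 hs)))).differentiableAt (by simp)
  have h2 : DifferentiableAt ℝ (fun s : ℝ => (y, s)) s := by fun_prop
  have h3 : DifferentiableAt ℝ (u y) s := 
    DifferentiableAt.comp (g := fun p : E2 × ℝ => u p.1 p.2) s h1 h2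
  exact h3.hasDerivAt

lemma lim_top {D : ℝ} (hD : 0 < D) (w x : E2) {t : ℝ} (ht : 0 < t) (u : E2 → ℝ → ℝ)
    (hsmooth : ContDiffOn ℝ (⊤ : ℕ∞) (fun p : E2 × ℝ => u p.1 p.2)
      (Set.univ ×ˢ Set.Ioi (0 : ℝ)))
    (hschwartz : ∀ t : ℝ, 0 ≤ t → ∃ φ : SchwartzMap E2 ℝ, ∀ x, u x t = φ x)
    (hdom : ∀ a b : ℝ, 0 < a → a ≤ b → ∃ g : E2 → ℝ, Integrable g ∧
        ∀ x : E2, ∀ t ∈ Set.Icc a b, |u x t| ≤ g x ∧ |deriv (u x) t| ≤ g x) :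
    Tendsto (fun s => ∫ y, advKernel D (t - s) w x y * u y s) (𝓝[<] t) (𝓝 (u x t)) := by
  obtain ⟨g, gi, hg⟩ := hdom (t / 2) t (by linarith) (by linarith)
  obtain ⟨φ, hφ⟩ := hschwartz t ht.le
  have g0 : ∀ y, 0 ≤ g y := fun y => 
    (abs_nonneg _).trans (hg y t ⟨by linarith, le_rfl⟩).1
  have hτ : Tendsto (fun s => t - s) (𝓝[<] t) (𝓝[>] 0) := by
    refine tendsto_nhdsWithin_iff.2 ⟨?_, ?_⟩
    · have : Continuous fun s => t - s := by fun_prop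
      have := this.tendsto t
      rw [sub_self] at this
      exact this.mono_left nhdsWithin_le_nhds
    · filter_upwards [self_mem_nhdsWithin] with s hs
      exact sub_pos.2 (Set.mem_Iio.1 hs)
  have hev : ∀ᶠ s in 𝓝[<] t, t / 2 < s ∧ s < t := by
    filter_upwards [self_mem_nhdsWithin, 
      mem_nhdsWithin_of_mem_nhds (Ioi_mem_nhds (show t / 2 < t by linarith))] with s h1 h2
    exact ⟨h2, h1⟩
  have h1 := (approx_id hD w x φ).comp hτ
  have hmv : ∀ y s, t / 2 < s → s < t → |u y s - φ y| ≤ g y * (t - s) := fun y s h1 h2 => by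
    rw [← hφ, abs_sub_comm]
    have := norm_image_sub_le_of_norm_deriv_le_segment' (f := u y) (f' := deriv (u y)) (a := s)
      (b := t) (C := g y)
      (fun r hr => (u_hasDerivAt hsmooth y (by linarith [hr.1])).hasDerivWithinAt)
      (fun r hr => (hg y r ⟨by linarith [hr.1], hr.2.le⟩).2) t ⟨h2.le, le_rfl⟩
    exact this
  have hb : ∀ y s, t / 2 < s → s < t → |advKernel D (t - s) w x y * (u y s - φ y)| ≤ 
      (4 * π * D)⁻¹ * g y * Real.exp (-‖x - (t - s) • w - y‖ ^ 2 / (4 * D * (t - s))) := 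
    fun y s h1 h2 => by
    have hp : 0 < t - s := by linarith
    rw [abs_mul, abs_of_nonneg (advK_nonneg hD hp w x y)]
    refine (mul_le_mul_of_nonneg_left (hmv y s h1 h2) (advK_nonneg hD hp w x y)).trans
      (le_of_eq ?_)
    unfold advKernel
    field_simp
  have hmeas : ∀ s, 0 < s → AEStronglyMeasurable
      (fun y => advKernel D (t - s) w x y * (u y s - φ y)) volume := fun s hs => by
    obtain ⟨ψ, hψ⟩ := hschwartz s hs.le
    simp_rw [hψ]
    refine Continuous.aestronglyMeasurable ?_
    have := ψ.continuous
    have := φ.continuous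
    have := advK_continuous D (t - s) w x
    fun_prop
  have hle : ∀ y s, s < t → 
      Real.exp (-‖x - (t - s) • w - y‖ ^ 2 / (4 * D * (t - s))) ≤ 1 := fun y s h2 => by
    have hp : 0 < t - s := by linarith
    rw [Real.exp_le_one_iff, neg_div]
    have : 0 ≤ ‖x - (t - s) • w - y‖ ^ 2 / (4 * D * (t - s)) := by positivity
    linarith
  have h2 : Tendsto (fun s => ∫ y, advKernel D (t - s) w x y * (u y s - φ y)) (𝓝[<] t) 
      (𝓝 (∫ y : E2, (0 : ℝ))) := by
    refine tendsto_integral_filter_of_dominated_convergence (fun y => (4 * π * D)⁻¹ * g y)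
      ?_ ?_ (gi.const_mul _) ?_
    · filter_upwards [hev] with s hs
      exact hmeas s (by linarith [hs.1])
    · filter_upwards [hev] with s hs
      refine Eventually.of_forall fun y => (hb y s hs.1 hs.2).trans ?_
      exact mul_le_of_le_one_right (mul_nonneg (by positivity) (g0 y)) (hle y s hs.2)
    · have hne : ∀ᵐ y : E2, y ≠ x := by
        simp [ae_iff, measure_singleton]
      filter_upwards [hne] with y hy
      have hlim : Tendsto (fun s => (4 * π * D)⁻¹ * g y * 
          Real.exp (-‖x - (t - s) • w - y‖ ^ 2 / (4 * D * (t - s)))) (𝓝[<] t) (𝓝 0) := by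
        rw [← mul_zero ((4 * π * D)⁻¹ * g y)]
        refine Tendsto.const_mul _ (Real.tendsto_exp_atBot.comp ?_)
        have e1 : Tendsto (fun s => -‖x - (t - s) • w - y‖ ^ 2 / (4 * D)) (𝓝[<] t) 
            (𝓝 (-‖x - y‖ ^ 2 / (4 * D))) := by
          have : Continuous (fun s => -‖x - (t - s) • w - y‖ ^ 2 / (4 * D)) := by fun_prop
          have := this.tendsto t
          simp only [sub_self, zero_smul, sub_zero] at this
          exact this.mono_left nhdsWithin_le_nhds
        have hneg : -‖x - y‖ ^ 2 / (4 * D) < 0 := by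
          have : 0 < ‖x - y‖ := norm_pos_iff.2 (sub_ne_zero.2 (Ne.symm hy))
          rw [neg_div]
          have : 0 < ‖x - y‖ ^ 2 / (4 * D) := by positivity
          linarith
        refine (e1.neg_mul_atTop hneg (tendsto_inv_nhdsGT_zero.comp hτ)).congr fun s => ?_
        simp only [Function.comp]
        rw [← div_eq_mul_inv, div_div]
      refine squeeze_zero_norm' ?_ hlim
      filter_upwards [hev] with s hs using hb y s hs.1 hs.2
  have h3 := h1.add h2
  rw [integral_zero, add_zero, ← hφ] at h3
  refine h3.congr' ?_
  filter_upwards [hev] with s hs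
  have hp : 0 < t - s := by linarith [hs.2]
  simp only [Function.comp]
  rw [← integral_add]
  · congr 1; funext y; ring
  · exact φ.integrable.bdd_mul (advK_continuous D (t - s) w x).aestronglyMeasurable 
      (c := (4 * π * D * (t - s))⁻¹) (ae_of_all _ fun y => by
        rw [Real.norm_of_nonneg (advK_nonneg hD hp w x y)]; exact advK_le hD hp w x y)
  · refine (gi.const_mul ((4 * π * D)⁻¹)).mono' (hmeas s (by linarith [hs.1])) ?_
    refine Eventually.of_forall fun y => (hb y s hs.1 hs.2).trans ?_
    exact mul_le_of_le_one_right (mul_nonneg (by positivity) (g0 y)) (hle y s hs.2)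

lemma gauss_poly {b : ℝ} (hb : 0 < b) (r : ℝ) (hr : 0 ≤ r) :
    (1 + r) ^ 3 * Real.exp (-(b * r ^ 2)) ≤ 48 / b ^ 3 * Real.exp b * ((1 + r) ^ 3)⁻¹ := by
  have h := Real.pow_div_factorial_le_exp _ (show 0 ≤ b * (1 + r ^ 2) by positivity) 3
  have h2 : (1 + r) ^ 6 ≤ 8 * (1 + r ^ 2) ^ 3 := by
    have : (1 + r) ^ 2 ≤ 2 * (1 + r ^ 2) := by nlinarith [sq_nonneg (r - 1)]
    calc (1 + r) ^ 6 = ((1 + r) ^ 2) ^ 3 := by ring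
      _ ≤ (2 * (1 + r ^ 2)) ^ 3 := by gcongr
      _ = _ := by ring
  have h3 : (1 + r) ^ 6 ≤ 48 / b ^ 3 * Real.exp b * Real.exp (b * r ^ 2) := by
    rw [mul_assoc, ← Real.exp_add]
    have : b + b * r ^ 2 = b * (1 + r ^ 2) := by ring
    rw [this]
    refine h2.trans ?_
    have := mul_le_mul_of_nonneg_left h (show 0 ≤ 48 / b ^ 3 by positivity)
    refine le_trans (le_of_eq ?_) this
    simp [Nat.factorial]
    field_simp
    norm_num
  rw [Real.exp_neg, ← div_eq_mul_inv, ← div_eq_mul_inv, div_le_div_iff₀ (by positivity) (by positivity)]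
  calc _ = (1 + r) ^ 6 := by ring
    _ ≤ _ := h3

lemma int_weight : Integrable (fun y : E2 => ((1 + ‖y‖) ^ 3)⁻¹) := by
  have := integrable_one_add_norm (E := E2) (μ := volume) (r := 3) (by simp; norm_num)
  refine this.congr (Eventually.of_forall fun y => ?_)
  simp only
  rw [Real.rpow_neg (by positivity)]
  norm_cast

lemma lim_bot {D : ℝ} (hD : 0 < D) (w x : E2) {t : ℝ} (ht : 0 < t) (u : E2 → ℝ → ℝ)
    (I₀ : SchwartzMap E2 ℝ)
    (hschwartz : ∀ t : ℝ, 0 ≤ t → ∃ φ : SchwartzMap E2 ℝ, ∀ x, u x t = φ x)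
    (hinit : ∀ ε : ℝ, 0 < ε → ∃ δ : ℝ, 0 < δ ∧ ∀ t ∈ Set.Ioo (0 : ℝ) δ,
      ∀ x : E2, |u x t - I₀ x| * ((1 + ‖x‖)⁻¹) ^ 3 ≤ ε) :
    Tendsto (fun s => ∫ y, advKernel D (t - s) w x y * u y s) (𝓝[>] 0)
      (𝓝 (∫ y, advKernel D t w x y * I₀ y)) := by
  have hw : ∀ (ε s : ℝ) (y : E2), |u y s - I₀ y| * ((1 + ‖y‖)⁻¹) ^ 3 ≤ ε → 
      |u y s - I₀ y| ≤ ε * (1 + ‖y‖) ^ 3 := fun ε s y h => by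
    rw [inv_pow, ← div_eq_mul_inv, div_le_iff₀ (by positivity)] at h
    exact h
  obtain ⟨δ, hδ, h1⟩ := hinit 1 one_pos
  set C := (4 * π * D * (t / 2))⁻¹ with hC
  set M := ‖x‖ + t * ‖w‖ with hM
  set b := (8 * D * t)⁻¹ with hb
  have hb0 : 0 < b := by positivity
  have hev : ∀ᶠ s in 𝓝[>] (0 : ℝ), 0 < s ∧ s < t / 2 ∧ s < δ := by
    filter_upwards [self_mem_nhdsWithin, 
      mem_nhdsWithin_of_mem_nhds (Iio_mem_nhds (show 0 < t / 2 by linarith)),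
      mem_nhdsWithin_of_mem_nhds (Iio_mem_nhds hδ)] with s h1 h2 h3
    exact ⟨h1, h2, h3⟩
  have hk1 : ∀ s y, 0 < s → s < t / 2 → advKernel D (t - s) w x y ≤ C := fun s y h0 h1 => by
    have hp : 0 < t - s := by linarith
    refine (advK_le hD hp w x y).trans ?_
    rw [hC]
    gcongr
    linarith
  have hk2 : ∀ s y, 0 < s → s < t / 2 → advKernel D (t - s) w x y ≤ 
      C * (Real.exp (2 * b * M ^ 2) * Real.exp (-(b * ‖y‖ ^ 2))) := fun s y h0 h1 => by
    have hp : 0 < t - s := by linarith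
    unfold advKernel
    rw [hC]
    have hA : (4 * π * D * (t - s))⁻¹ ≤ (4 * π * D * (t / 2))⁻¹ := by
      gcongr
      linarith
    refine mul_le_mul hA ?_ (by positivity) (by positivity)
    rw [← Real.exp_add, Real.exp_le_exp]
    have ha : ‖x - (t - s) • w‖ ≤ M := by
      refine (norm_sub_le _ _).trans ?_
      rw [norm_smul, Real.norm_of_nonneg hp.le, hM]
      gcongr
      linarith
    have hy : ‖y‖ ≤ M + ‖x - (t - s) • w - y‖ := by
      have : y = (x - (t - s) • w) - (x - (t - s) • w - y) := by abel
      calc ‖y‖ = ‖(x - (t - s) • w) - (x - (t - s) • w - y)‖ := by rw [← this]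
        _ ≤ _ := (norm_sub_le _ _).trans (by gcongr)
    set r := ‖x - (t - s) • w - y‖
    have hr : 0 ≤ r := norm_nonneg _
    have hq : ‖y‖ ^ 2 ≤ 2 * M ^ 2 + 2 * r ^ 2 := by
      have : ‖y‖ ^ 2 ≤ (M + r) ^ 2 := by gcongr
      nlinarith [sq_nonneg (M - r)]
    have h5 : 2 * b * r ^ 2 ≤ r ^ 2 / (4 * D * (t - s)) := by
      have : 2 * b * r ^ 2 = r ^ 2 / (4 * D * t) := by rw [hb]; field_simp; ring
      rw [this]
      gcongr
      linarith
    rw [neg_div]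
    nlinarith [mul_le_mul_of_nonneg_left hq hb0.le]
  refine tendsto_integral_filter_of_dominated_convergence 
    (fun y => C * |I₀ y| + C * Real.exp (2 * b * M ^ 2) * (48 / b ^ 3 * Real.exp b) * ((1 + ‖y‖) ^ 3)⁻¹)
      ?_ ?_ ?_ ?_
  · filter_upwards [hev] with s hs
    obtain ⟨ψ, hψ⟩ := hschwartz s hs.1.le
    simp_rw [hψ]
    refine Continuous.aestronglyMeasurable ?_
    have := ψ.continuous
    have := advK_continuous D (t - s) w x
    fun_prop
  · filter_upwards [hev] with s hs
    refine Eventually.of_forall fun y => ?_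
    have hp : 0 < t - s := by linarith [hs.2.1]
    have k0 := advK_nonneg hD hp w x y
    have hd := hw 1 s y (h1 s ⟨hs.1, hs.2.2⟩ y)
    rw [one_mul] at hd
    have hu : |u y s| ≤ |I₀ y| + |u y s - I₀ y| := by
      have := abs_add_le (I₀ y) (u y s - I₀ y)
      simpa using this
    rw [norm_mul, Real.norm_of_nonneg k0, Real.norm_eq_abs]
    calc _ ≤ advKernel D (t - s) w x y * (|I₀ y| + (1 + ‖y‖) ^ 3) := by gcongr; linarith
      _ = advKernel D (t - s) w x y * |I₀ y| + advKernel D (t - s) w x y * (1 + ‖y‖) ^ 3 := by ring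
      _ ≤ C * |I₀ y| + (C * (Real.exp (2 * b * M ^ 2) * Real.exp (-(b * ‖y‖ ^ 2)))) * (1 + ‖y‖) ^ 3 := by
          gcongr
          · exact hk1 s y hs.1 hs.2.1
          · exact hk2 s y hs.1 hs.2.1
      _ = C * |I₀ y| + (C * Real.exp (2 * b * M ^ 2)) * ((1 + ‖y‖) ^ 3 * Real.exp (-(b * ‖y‖ ^ 2))) := by ring
      _ ≤ C * |I₀ y| + (C * Real.exp (2 * b * M ^ 2)) * 
            (48 / b ^ 3 * Real.exp b * ((1 + ‖y‖) ^ 3)⁻¹) := by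
          have hg := gauss_poly hb0 _ (norm_nonneg y)
          have hC0 : 0 ≤ C * Real.exp (2 * b * M ^ 2) := by positivity
          exact add_le_add le_rfl (mul_le_mul_of_nonneg_left hg hC0)
      _ = _ := by ring
  · exact (I₀.integrable.abs.const_mul C).add (int_weight.const_mul _)
  · refine Eventually.of_forall fun y => Tendsto.mul ?_ ?_
    · have hc : ContinuousAt (fun s => advKernel D (t - s) w x y) 0 := 
        (advK_time D t 0 hD ht w x y).continuousAt
      have := hc.tendsto
      simp only [sub_zero] at this
      exact this.mono_left nhdsWithin_le_nhds
    · rw [Metric.tendsto_nhds]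
      intro ε hε
      obtain ⟨δ', hδ', h2⟩ := hinit (ε / 2 * ((1 + ‖y‖) ^ 3)⁻¹) (by positivity)
      filter_upwards [self_mem_nhdsWithin, 
        mem_nhdsWithin_of_mem_nhds (Iio_mem_nhds hδ')] with s h3 h4
      have := hw _ s y (h2 s ⟨h3, h4⟩ y)
      rw [mul_assoc, inv_mul_cancel₀ (by positivity), mul_one] at this
      rw [Real.dist_eq]
      linarith

lemma advF_deriv {D : ℝ} (hD : 0 < D) (w x : E2) {t s : ℝ} (hs0 : 0 < s) (hst : s < t)
    (u : E2 → ℝ → ℝ)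
    (hsmooth : ContDiffOn ℝ (⊤ : ℕ∞) (fun p : E2 × ℝ => u p.1 p.2)
      (Set.univ ×ˢ Set.Ioi (0 : ℝ)))
    (hschwartz : ∀ t : ℝ, 0 ≤ t → ∃ φ : SchwartzMap E2 ℝ, ∀ x, u x t = φ x)
    (hdom : ∀ a b : ℝ, 0 < a → a ≤ b → ∃ g : E2 → ℝ, Integrable g ∧
        ∀ x : E2, ∀ t ∈ Set.Icc a b, |u x t| ≤ g x ∧ |deriv (u x) t| ≤ g x)
    (hpde : ∀ x : E2, ∀ t : ℝ, 0 < t →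
      deriv (u x) t + fderiv ℝ (fun y => u y t) x w = D * laplacian (fun y => u y t) x) :
    HasDerivAt (fun s => ∫ y, advKernel D (t - s) w x y * u y s) 0 s := by
  obtain ⟨g, gi, hg⟩ := hdom (s / 2) ((s + t) / 2) (by linarith) (by linarith)
  set α := (t - s) / 2 with hα
  have hα0 : 0 < α := by rw [hα]; linarith
  set B := (4 * π * D * α)⁻¹ * (2 * α⁻¹ + ((2 * D * α)⁻¹ + 2) * ‖w‖) with hB
  set A := (4 * π * D * α)⁻¹ with hA
  have hB0 : 0 ≤ B := by positivity
  have hA0 : 0 ≤ A := by positivity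
  have g0 : ∀ y, 0 ≤ g y := fun y => 
    (abs_nonneg _).trans (hg y s ⟨by linarith, by linarith⟩).1
  have hkA : ∀ r y, r ≤ (s + t) / 2 → |advKernel D (t - r) w x y| ≤ A := fun r y hr => by
    have hp : α ≤ t - r := by rw [hα]; linarith
    have hp0 : 0 < t - r := by linarith
    rw [abs_of_nonneg (advK_nonneg hD hp0 w x y), hA]
    refine (advK_le hD hp0 w x y).trans ?_
    gcongr
  obtain ⟨φ, hφ⟩ := hschwartz s hs0.le
  have hφ' : (fun y => u y s) = φ := funext hφ
  have hder : ∀ y, deriv (u y) s = D * laplacian φ y - fderiv ℝ φ y w := fun y => by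
    have := hpde y s hs0
    rw [hφ'] at this
    linarith
  have hderc : Continuous fun y => D * laplacian φ y - fderiv ℝ φ y w := by
    have c1 : ∀ v : E2, Continuous fun y => fderiv ℝ φ y v := fun v =>
      (LineDeriv.lineDerivOp v φ : SchwartzMap E2 ℝ).continuous
    have c2 : ∀ v : E2, Continuous fun y => fderiv ℝ (fun z => fderiv ℝ φ z v) y v := fun v =>
      (LineDeriv.lineDerivOp v (LineDeriv.lineDerivOp v φ : SchwartzMap E2 ℝ) : 
        SchwartzMap E2 ℝ).continuous
    unfold laplacian
    exact (continuous_const.mul (continuous_finset_sum _ fun i _ => c2 _)).sub (c1 w)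
  have hkc := advK_continuous D (t - s) w x
  have := (hasDerivAt_integral_of_dominated_loc_of_deriv_le (μ := (volume : Measure E2))
    (F := fun s y => advKernel D (t - s) w x y * u y s)
    (F' := fun s y => (advKernel D (t - s) w x y * ((t - s)⁻¹ - 
        ‖x - (t - s) • w - y‖ ^ 2 / (4 * D * (t - s) ^ 2)
        - inner ℝ (x - (t - s) • w - y) w / (2 * D * (t - s)))) * u y s + 
        advKernel D (t - s) w x y * deriv (u y) s) (x₀ := s) 
    (s := Set.Ioo (s / 2) ((s + t) / 2)) (bound := fun y => (B + A) * g y)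
    (Ioo_mem_nhds (by linarith) (by linarith)) ?_ ?_ ?_ ?_ (gi.const_mul _) ?_).2
  · refine this.congr_deriv ?_
    simp_rw [hder, hφ]
    exact adjoint_identity hD (sub_pos.2 hst) w x φ
  · filter_upwards [Ioi_mem_nhds hs0] with r hr
    obtain ⟨ψ, hψ⟩ := hschwartz r (le_of_lt hr)
    simp_rw [hψ]
    exact ((advK_continuous D (t - r) w x).mul ψ.continuous).aestronglyMeasurable
  · simp_rw [hφ]
    exact φ.integrable.bdd_mul hkc.aestronglyMeasurable 
      (c := A) (ae_of_all _ fun y => hkA s y (by linarith))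
  · simp_rw [hder, hφ]
    refine Continuous.aestronglyMeasurable ?_
    have := φ.continuous
    fun_prop
  · refine Eventually.of_forall fun y r hr => ?_
    have hgr := hg y r ⟨hr.1.le, hr.2.le⟩
    have hp : α ≤ t - r := by rw [hα]; linarith [hr.2]
    have hb1 := advK_time_bound hD hα0 hp w x y
    rw [← hB] at hb1
    refine (norm_add_le _ _).trans ?_
    rw [norm_mul, norm_mul (advKernel _ _ _ _ _) (deriv _ _), add_mul]
    exact add_le_add (mul_le_mul hb1 hgr.1 (abs_nonneg _) hB0) 
      (mul_le_mul (hkA r y hr.2.le) hgr.2 (abs_nonneg _) hA0)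
  · refine Eventually.of_forall fun y r hr => ?_
    exact (advK_time D t r hD (by linarith [hr.2]) w x y).mul 
      (u_hasDerivAt hsmooth y (by linarith [hr.1]))

/-- Uniqueness: a solution `u` of the advection–diffusion equation on `ℝ² × (0, ∞)` with
Schwartz initial datum `I₀`, continuous up to `t = 0`, Schwartz in `x` for every `t ≥ 0`,
suitably dominated on compact subintervals of `(0, ∞)`, and attaining `I₀` in the
weighted-sup sense as `t → 0⁺`, is necessarily given by convolution with the advected
heat kernel: `u(x, t) = ∫ (4πDt)⁻¹ exp(−‖x − tw − y‖²/(4Dt)) I₀(y) dy`. -/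
theorem advection_diffusion_uniqueness
    (D : ℝ) (hD : 0 < D) (w : EuclideanSpace ℝ (Fin 2))
    (I₀ : SchwartzMap (EuclideanSpace ℝ (Fin 2)) ℝ)
    (u : EuclideanSpace ℝ (Fin 2) → ℝ → ℝ)
    (hcont : ContinuousOn (fun p : EuclideanSpace ℝ (Fin 2) × ℝ => u p.1 p.2)
      (Set.univ ×ˢ Set.Ici (0 : ℝ)))
    (hu0 : ∀ x : EuclideanSpace ℝ (Fin 2), u x 0 = I₀ x)
    (hsmooth : ContDiffOn ℝ (⊤ : ℕ∞) (fun p : EuclideanSpace ℝ (Fin 2) × ℝ => u p.1 p.2)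
      (Set.univ ×ˢ Set.Ioi (0 : ℝ)))
    (hschwartz : ∀ t : ℝ, 0 ≤ t →
      ∃ φ : SchwartzMap (EuclideanSpace ℝ (Fin 2)) ℝ, ∀ x, u x t = φ x)
    (hdom : ∀ a b : ℝ, 0 < a → a ≤ b →
      ∃ g : EuclideanSpace ℝ (Fin 2) → ℝ, Integrable g ∧
        ∀ x : EuclideanSpace ℝ (Fin 2), ∀ t ∈ Set.Icc a b,
          |u x t| ≤ g x ∧ |deriv (u x) t| ≤ g x)
    (hinit : ∀ ε : ℝ, 0 < ε → ∃ δ : ℝ, 0 < δ ∧ ∀ t ∈ Set.Ioo (0 : ℝ) δ,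
      ∀ x : EuclideanSpace ℝ (Fin 2), |u x t - I₀ x| * ((1 + ‖x‖)⁻¹) ^ 3 ≤ ε)
    (hpde : ∀ x : EuclideanSpace ℝ (Fin 2), ∀ t : ℝ, 0 < t →
      deriv (u x) t + fderiv ℝ (fun y => u y t) x w = D * laplacian (fun y => u y t) x) :
    ∀ x : EuclideanSpace ℝ (Fin 2), ∀ t : ℝ, 0 < t →
      u x t = ∫ y : EuclideanSpace ℝ (Fin 2), advKernel D t w x y * I₀ y := by
  intro x t ht
  set F : ℝ → ℝ := fun s => ∫ y, advKernel D (t - s) w x y * u y s with hF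
  have hd : ∀ s ∈ Set.Ioo 0 t, HasDerivAt F 0 s := fun s hs =>
    advF_deriv hD w x hs.1 hs.2 u hsmooth hschwartz hdom hpde
  obtain ⟨c, hc⟩ := isOpen_Ioo.exists_is_const_of_deriv_eq_zero (𝕜 := ℝ) (f := F)
    (isPreconnected_Ioo (a := 0) (b := t))
    (fun s hs => (hd s hs).differentiableAt.differentiableWithinAt)
    (fun s hs => (hd s hs).deriv)
  have h1 := lim_top hD w x ht u hsmooth hschwartz hdom
  have h2 := lim_bot hD w x ht u I₀ hschwartz hinit
  have e1 : Tendsto F (𝓝[<] t) (𝓝 c) := by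
    refine tendsto_const_nhds.congr' ?_
    filter_upwards [Ioo_mem_nhdsLT ht] with s hs using (hc s hs).symm
  have e2 : Tendsto F (𝓝[>] 0) (𝓝 c) := by
    refine tendsto_const_nhds.congr' ?_
    filter_upwards [Ioo_mem_nhdsGT ht] with s hs using (hc s hs).symm
  rw [tendsto_nhds_unique h1 e1, tendsto_nhds_unique h2 e2]
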